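/- arXiv:2403.18371 — 3 statements merged into one kernel-verified Lean document; each statement's English description precedes it below -/
import Mathlib

section
/- Let P be an n×n real symmetric positive definite matrix, K an m×n real matrix, and h ∈ ℝᵐ. Then hᵀ K P⁻¹ Kᵀ h ≤ 1 if and only if for every x ∈ ℝⁿ with xᵀ P x ≤ 1 one has hᵀ (K x) ≤ 1, i.e. the image K·S_P of the ellipsoid S_P = {x : xᵀ P x ≤ 1} under K is contained in the half-space {u ∈ ℝᵐ : hᵀ u ≤ 1}. -/
open Matrix

/-- The ellipsoid of a positive definite matrix `P` lies in the half-space `{x : gᵀ x ≤ 1}` iff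
`g` lies in the polar ellipsoid, that is `gᵀ P⁻¹ g ≤ 1`. -/
theorem Matrix.PosDef.dotProduct_inv_mulVec_le_one_iff {ι : Type*} [Fintype ι] [DecidableEq ι]
    {P : Matrix ι ι ℝ} (hP : P.PosDef) (g : ι → ℝ) :
    g ⬝ᵥ (P⁻¹ *ᵥ g) ≤ 1 ↔ ∀ x : ι → ℝ, x ⬝ᵥ (P *ᵥ x) ≤ 1 → g ⬝ᵥ x ≤ 1 := by
  have hdet : IsUnit P.det := (Matrix.isUnit_iff_isUnit_det P).mp hP.isUnit
  have hPy : P *ᵥ (P⁻¹ *ᵥ g) = g := by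
    rw [mulVec_mulVec, mul_nonsing_inv P hdet, one_mulVec]
  have hsymm : Pᵀ = P := by simpa using hP.isHermitian.eq
  set y := P⁻¹ *ᵥ g
  constructor
  · intro hq x hx
    have hnonneg : 0 ≤ (x - y) ⬝ᵥ (P *ᵥ (x - y)) := by
      simpa using hP.posSemidef.dotProduct_mulVec_nonneg (x - y)
    have hcross : y ⬝ᵥ (P *ᵥ x) = g ⬝ᵥ x := by
      rw [dotProduct_mulVec, ← mulVec_transpose, hsymm, hPy]
    rw [mulVec_sub, hPy, sub_dotProduct, dotProduct_sub, dotProduct_sub, hcross,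
      dotProduct_comm x g, dotProduct_comm y g] at hnonneg
    linarith
  · intro hx
    by_contra! hq
    have hs : 1 < √(g ⬝ᵥ y) := by rwa [Real.lt_sqrt zero_le_one, one_pow]
    have hsq : √(g ⬝ᵥ y) * √(g ⬝ᵥ y) = g ⬝ᵥ y := Real.mul_self_sqrt (by linarith)
    set s := √(g ⬝ᵥ y)
    have hs0 : s ≠ 0 := by positivity
    have hle := hx (s⁻¹ • y) <| by
      rw [mulVec_smul, hPy, smul_dotProduct, dotProduct_smul, dotProduct_comm y g, ← hsq,
        smul_eq_mul, smul_eq_mul, inv_mul_cancel_left₀ hs0, inv_mul_cancel₀ hs0]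
    rw [dotProduct_smul, ← hsq, smul_eq_mul, inv_mul_cancel_left₀ hs0] at hle
    linarith

/-- Input-constraint admissibility: `hᵀ K P⁻¹ Kᵀ h ≤ 1` iff the image of the
ellipsoid `S_P` under `K` is contained in the half-space `{u : hᵀ u ≤ 1}`. -/
theorem stmt_4 {n m : ℕ} (P : Matrix (Fin n) (Fin n) ℝ)
    (K : Matrix (Fin m) (Fin n) ℝ) (h : Fin m → ℝ)
    (hP : P.PosDef) :
    h ⬝ᵥ ((K * P⁻¹ * Kᵀ) *ᵥ h) ≤ 1 ↔
      ∀ x : Fin n → ℝ, x ⬝ᵥ (P *ᵥ x) ≤ 1 → h ⬝ᵥ (K *ᵥ x) ≤ 1 := by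
  have hK (x : Fin n → ℝ) : h ⬝ᵥ (K *ᵥ x) = (Kᵀ *ᵥ h) ⬝ᵥ x := by
    rw [dotProduct_mulVec, mulVec_transpose]
  simp only [← mulVec_mulVec, hK]
  exact hP.dotProduct_inv_mulVec_le_one_iff _
end

section
/- Let A, Π ∈ ℝ^{n×n}, B ∈ ℝ^{n×m}, E ∈ ℝ^{n×p}, C, O with C ∈ ℝ^{q×n}, O ∈ ℝ^{q×p}, S ∈ ℝ^{p×p}, Γ ∈ ℝ^{m×p}, and K ∈ ℝ^{m×n}. Assume the Sylvester equations Π S = A Π + B Γ + E and C Π = O hold, and assume there exists a symmetric positive definite P with (A + B K)ᵀ P (A + B K) ≺ P. Consider the closed-loop system x(k+1) = A x(k) + B u(k) + E w(k), w(k+1) = S w(k), u(k) = K x(k) + (Γ − K Π) w(k). Then for every initial condition x(0) ∈ ℝⁿ, w(0) ∈ ℝᵖ, the output tracking error e(k) := C x(k) − O w(k) converges to 0 as k → ∞. -/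
open Matrix Filter

open scoped MatrixOrder in
/-- A positive definite quadratic form that tends to zero along a filter forces its argument to
tend to zero. -/
theorem Matrix.PosDef.tendsto_zero_of_tendsto_dotProduct {ι α : Type*} [Fintype ι]
    {Q : Matrix ι ι ℝ} (hQ : Q.PosDef) {l : Filter α} {z : α → ι → ℝ}
    (h : Tendsto (fun a => z a ⬝ᵥ Q *ᵥ z a) l (nhds 0)) : Tendsto z l (nhds 0) := by
  classical
  obtain ⟨R, rfl⟩ : ∃ R : Matrix ι ι ℝ, Q = Rᴴ * R :=
    CStarAlgebra.nonneg_iff_eq_star_mul_self.mp hQ.posSemidef.nonneg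
  have hR : IsUnit R := isUnit_of_mul_isUnit_right hQ.isUnit
  have hform (a : α) : z a ⬝ᵥ (Rᴴ * R) *ᵥ z a = (R *ᵥ z a) ⬝ᵥ (R *ᵥ z a) := by
    rw [← mulVec_mulVec, dotProduct_mulVec, conjTranspose_eq_transpose_of_trivial,
      vecMul_transpose]
  simp only [hform] at h
  have hRz : Tendsto (fun a => R *ᵥ z a) l (nhds 0) := by
    refine tendsto_pi_nhds.mpr fun i => ?_
    have hsq : Tendsto (fun a => (R *ᵥ z a) i * (R *ᵥ z a) i) l (nhds 0) :=
      squeeze_zero (fun a => mul_self_nonneg _) (fun a =>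
        Finset.single_le_sum (f := fun j => (R *ᵥ z a) j * (R *ᵥ z a) j)
          (fun j _ => mul_self_nonneg _) (Finset.mem_univ i)) h
    have habs := hsq.sqrt
    simp only [Real.sqrt_mul_self_eq_abs, Real.sqrt_zero] at habs
    exact (tendsto_zero_iff_abs_tendsto_zero _).mpr habs
  have hcont : Continuous fun v : ι → ℝ => R⁻¹ *ᵥ v :=
    continuous_const.matrix_mulVec continuous_id
  have hinv := (hcont.tendsto 0).comp hRz
  have hdet : IsUnit R.det := (isUnit_iff_isUnit_det R).mp hR
  simpa [Function.comp_def, mulVec_mulVec, nonsing_inv_mul R hdet] using hinv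

/-- Discrete-time Lyapunov stability: trajectories of `z (k + 1) = M z k` converge to zero when
`Mᵀ P M ≺ P` for a positive semidefinite `P`. -/
theorem Matrix.tendsto_zero_of_lyapunov {ι : Type*} [Fintype ι] {M P : Matrix ι ι ℝ}
    (hP : P.PosSemidef) (hM : (P - Mᵀ * P * M).PosDef) {z : ℕ → ι → ℝ}
    (hz : ∀ k, z (k + 1) = M *ᵥ z k) : Tendsto z atTop (nhds 0) := by
  apply hM.tendsto_zero_of_tendsto_dotProduct
  set V : ℕ → ℝ := fun k => z k ⬝ᵥ P *ᵥ z k with hV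
  have hV_nonneg (k : ℕ) : 0 ≤ V k := by simpa using hP.dotProduct_mulVec_nonneg (z k)
  have hdec (k : ℕ) : z k ⬝ᵥ (P - Mᵀ * P * M) *ᵥ z k = V k - V (k + 1) := by
    simp only [hV, hz, sub_mulVec, dotProduct_sub, ← mulVec_mulVec]
    rw [dotProduct_mulVec (z k) Mᵀ, vecMul_transpose]
  have hdec_nonneg (k : ℕ) : 0 ≤ V k - V (k + 1) := by
    rw [← hdec]
    simpa using hM.posSemidef.dotProduct_mulVec_nonneg (z k)
  have hanti : Antitone V := antitone_nat_of_succ_le fun k => sub_nonneg.mp (hdec_nonneg k)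
  have hlim := tendsto_atTop_ciInf hanti ⟨0, by rintro _ ⟨k, rfl⟩; exact hV_nonneg k⟩
  simpa only [hdec, sub_self, Function.comp_apply] using
    hlim.sub (hlim.comp (tendsto_add_atTop_nat 1))

/-- Zero asymptotic output tracking error: under the Sylvester equations
`Π S = A Π + B Γ + E` and `C Π = O`, and the Lyapunov condition
`(A + B K)ᵀ P (A + B K) ≺ P` for some `P ≻ 0`, the closed-loop output
tracking error `e(k) = C x(k) − O w(k)` converges to `0` for every initial
condition. -/
theorem stmt_10 {n m p q : ℕ}
    (A : Matrix (Fin n) (Fin n) ℝ)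
    (Pi : Matrix (Fin n) (Fin p) ℝ)
    (B : Matrix (Fin n) (Fin m) ℝ)
    (E : Matrix (Fin n) (Fin p) ℝ)
    (C : Matrix (Fin q) (Fin n) ℝ)
    (O : Matrix (Fin q) (Fin p) ℝ)
    (S : Matrix (Fin p) (Fin p) ℝ)
    (Γ : Matrix (Fin m) (Fin p) ℝ)
    (K : Matrix (Fin m) (Fin n) ℝ)
    (hSyl1 : Pi * S = A * Pi + B * Γ + E)
    (hSyl2 : C * Pi = O)
    (P : Matrix (Fin n) (Fin n) ℝ) (hP : P.PosDef)
    (hLyap : (P - (A + B * K)ᵀ * P * (A + B * K)).PosDef)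
    (x : ℕ → Fin n → ℝ) (w : ℕ → Fin p → ℝ) (u : ℕ → Fin m → ℝ)
    (hw : ∀ k, w (k + 1) = S *ᵥ w k)
    (hx : ∀ k, x (k + 1) = A *ᵥ x k + B *ᵥ u k + E *ᵥ w k)
    (hu : ∀ k, u k = K *ᵥ x k + (Γ - K * Pi) *ᵥ w k) :
    Tendsto (fun k : ℕ => C *ᵥ x k - O *ᵥ w k) atTop (nhds 0) := by
  have herr (k : ℕ) :
      x (k + 1) - Pi *ᵥ w (k + 1) = (A + B * K) *ᵥ (x k - Pi *ᵥ w k) := by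
    rw [hx, hu, hw, mulVec_mulVec, hSyl1]
    simp only [add_mulVec, sub_mulVec, mulVec_add, mulVec_sub, mulVec_mulVec, Matrix.mul_assoc,
      Matrix.add_mul]
    abel
  have hlim := Matrix.tendsto_zero_of_lyapunov hP.posSemidef hLyap
    (z := fun k => x k - Pi *ᵥ w k) herr
  have hcont : Continuous fun v : Fin n → ℝ => C *ᵥ v :=
    continuous_const.matrix_mulVec continuous_id
  simpa [Function.comp_def, mulVec_sub, mulVec_mulVec, hSyl2] using (hcont.tendsto 0).comp hlim
end

section
/- Let P be an n×n real symmetric positive definite matrix, A an n×n real matrix, K an m×n real matrix, and g ∈ ℝⁿ, h ∈ ℝᵐ. Assume (i) Aᵀ P A ≺ P, (ii) gᵀ P⁻¹ g ≤ 1, and (iii) hᵀ K P⁻¹ Kᵀ h ≤ 1. Then for every e₀ ∈ ℝⁿ with e₀ᵀ P e₀ ≤ 1, the trajectory e(k) := Aᵏ e₀ of e(k+1) = A e(k) satisfies, for all k ∈ ℕ: e(k)ᵀ P e(k) ≤ 1, gᵀ e(k) ≤ 1, and hᵀ (K e(k)) ≤ 1; moreover e(k) → 0 as k → ∞. -/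
open Matrix Filter

/-- The Cauchy–Schwarz inequality for the dual pair of quadratic forms of `P` and `P⁻¹`. -/
theorem Matrix.PosDef.sq_dotProduct_le {ι : Type*} [Fintype ι] [DecidableEq ι]
    {P : Matrix ι ι ℝ} (hP : P.PosDef) (g x : ι → ℝ) :
    (g ⬝ᵥ x) ^ 2 ≤ (g ⬝ᵥ (P⁻¹ *ᵥ g)) * (x ⬝ᵥ (P *ᵥ x)) := by
  have hPT : Pᵀ = P := by simpa using hP.isHermitian.eq
  have hPw : P *ᵥ (P⁻¹ *ᵥ g) = g := by
    rw [mulVec_mulVec, mul_nonsing_inv _ ((isUnit_iff_isUnit_det _).1 hP.isUnit), one_mulVec]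
  have hwP : (P⁻¹ *ᵥ g) ⬝ᵥ (P *ᵥ x) = g ⬝ᵥ x := by
    rw [dotProduct_mulVec, ← mulVec_transpose, hPT, hPw]
  have key : ∀ t : ℝ, 0 ≤ (x ⬝ᵥ (P *ᵥ x)) * (t * t) + (2 * (g ⬝ᵥ x)) * t +
      g ⬝ᵥ (P⁻¹ *ᵥ g) := by
    intro t
    have h := hP.posSemidef.dotProduct_mulVec_nonneg (P⁻¹ *ᵥ g + t • x)
    simp only [star_trivial, mulVec_add, mulVec_smul, hPw, add_dotProduct, dotProduct_add,
      smul_dotProduct, dotProduct_smul, hwP, smul_eq_mul, dotProduct_comm x g,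
      dotProduct_comm (P⁻¹ *ᵥ g) g] at h
    linarith
  have := discrim_le_zero key
  rw [discrim] at this
  linarith

/-- A sequence along which a positive definite quadratic form tends to `0` tends to `0`. -/
theorem Matrix.PosDef.tendsto_zero {ι α : Type*} [Fintype ι] {l : Filter α}
    {Q : Matrix ι ι ℝ} (hQ : Q.PosDef) {x : α → ι → ℝ}
    (hx : Tendsto (fun k => x k ⬝ᵥ (Q *ᵥ x k)) l (nhds 0)) : Tendsto x l (nhds 0) := by
  classical
  refine tendsto_pi_nhds.2 fun i => ?_
  have hsq : Tendsto (fun k => x k i ^ 2) l (nhds 0) := by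
    refine squeeze_zero (fun k => sq_nonneg _) (fun k => ?_)
      (by simpa using hx.const_mul (Pi.single i 1 ⬝ᵥ (Q⁻¹ *ᵥ Pi.single i 1)))
    simpa using hQ.sq_dotProduct_le (Pi.single i 1) (x k)
  have habs := hsq.sqrt
  simp only [Real.sqrt_sq_eq_abs, Real.sqrt_zero] at habs
  exact (tendsto_zero_iff_abs_tendsto_zero _).2 habs

/-- The decrease of the quadratic form of `P` along `x ↦ A x` is the quadratic form of
`P - Aᵀ P A`. -/
theorem Matrix.dotProduct_sub_transpose_mul_mul_mulVec {ι : Type*} [Fintype ι]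
    (P A : Matrix ι ι ℝ) (x : ι → ℝ) :
    x ⬝ᵥ ((P - Aᵀ * P * A) *ᵥ x) = x ⬝ᵥ (P *ᵥ x) - (A *ᵥ x) ⬝ᵥ (P *ᵥ (A *ᵥ x)) := by
  rw [sub_mulVec, dotProduct_sub, ← mulVec_mulVec, ← mulVec_mulVec,
    dotProduct_mulVec x Aᵀ, vecMul_transpose]

/-- Trajectory-level conclusion of Theorem 1 (Controller Synthesis):
under the Lyapunov LMI `Aᵀ P A ≺ P` and the constraint-admissibility
conditions `gᵀ P⁻¹ g ≤ 1` and `hᵀ K P⁻¹ Kᵀ h ≤ 1`, every trajectory started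
in the ellipsoid `S_P` stays in it, satisfies the state and input constraints
at all times, and converges to the origin. -/
theorem stmt_11 {n m : ℕ}
    (P A : Matrix (Fin n) (Fin n) ℝ)
    (K : Matrix (Fin m) (Fin n) ℝ)
    (g : Fin n → ℝ) (h : Fin m → ℝ)
    (hP : P.PosDef)
    (hLyap : (P - Aᵀ * P * A).PosDef)
    (hg : g ⬝ᵥ (P⁻¹ *ᵥ g) ≤ 1)
    (hh : h ⬝ᵥ ((K * P⁻¹ * Kᵀ) *ᵥ h) ≤ 1) :
    ∀ e₀ : Fin n → ℝ, e₀ ⬝ᵥ (P *ᵥ e₀) ≤ 1 →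
      (∀ k : ℕ, ((A ^ k) *ᵥ e₀) ⬝ᵥ (P *ᵥ ((A ^ k) *ᵥ e₀)) ≤ 1 ∧
          g ⬝ᵥ ((A ^ k) *ᵥ e₀) ≤ 1 ∧
          h ⬝ᵥ (K *ᵥ ((A ^ k) *ᵥ e₀)) ≤ 1) ∧
        Tendsto (fun k : ℕ => (A ^ k) *ᵥ e₀) atTop (nhds 0) := by
  intro e₀ he₀
  have hsucc : ∀ k, A ^ (k + 1) *ᵥ e₀ = A *ᵥ (A ^ k *ᵥ e₀) := fun k => by
    rw [pow_succ', mulVec_mulVec]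
  set V : ℕ → ℝ := fun k => (A ^ k *ᵥ e₀) ⬝ᵥ (P *ᵥ (A ^ k *ᵥ e₀)) with hV
  have hdiff : ∀ k, (A ^ k *ᵥ e₀) ⬝ᵥ ((P - Aᵀ * P * A) *ᵥ (A ^ k *ᵥ e₀)) = V k - V (k + 1) :=
    fun k => by
      simp only [hV, hsucc]
      exact dotProduct_sub_transpose_mul_mul_mulVec P A _
  have hV0 : ∀ k, 0 ≤ V k := fun k =>
    hP.posSemidef.dotProduct_mulVec_nonneg (A ^ k *ᵥ e₀)
  have hanti : Antitone V := antitone_nat_of_succ_le fun k => by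
    have h := hLyap.posSemidef.dotProduct_mulVec_nonneg (A ^ k *ᵥ e₀)
    rw [star_trivial, hdiff] at h
    linarith
  have hV1 : ∀ k, V k ≤ 1 := fun k =>
    (hanti (Nat.zero_le k)).trans (by simpa [hV] using he₀)
  have hhalf : ∀ c : Fin n → ℝ, c ⬝ᵥ (P⁻¹ *ᵥ c) ≤ 1 → ∀ k, c ⬝ᵥ (A ^ k *ᵥ e₀) ≤ 1 :=
    fun c hc k => (abs_le.1 (abs_le_one_iff_mul_self_le_one.2 (by
      rw [← sq]
      exact (hP.sq_dotProduct_le c _).trans (mul_le_one₀ hc (hV0 k) (hV1 k))))).2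
  refine ⟨fun k => ⟨hV1 k, hhalf g hg k, ?_⟩, hLyap.tendsto_zero ?_⟩
  · rw [dotProduct_mulVec, ← mulVec_transpose]
    refine hhalf _ ?_ k
    rwa [← mulVec_mulVec, ← mulVec_mulVec, dotProduct_mulVec, ← mulVec_transpose] at hh
  · have hlim := tendsto_atTop_ciInf hanti ⟨0, by rintro _ ⟨k, rfl⟩; exact hV0 k⟩
    simpa only [hdiff, sub_self] using hlim.sub ((tendsto_add_atTop_iff_nat 1).2 hlim)
end
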